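/- arXiv:1708.08808 — 8 statements merged into one kernel-verified Lean document; each statement's English description precedes it below -/
import Mathlib

section
/- For every integer n ≥ 2, the inequality ∫₀^∞ u^{n−1} e^{−u²/4} du < 2√π · (2(n−1))^{(n−1)/2} · e^{−(n−1)/2} holds; that is, L_{n,P} < L_{n,C}, the self-shrinking half-line is shorter than the self-shrinking cylinder. -/
open Real MeasureTheory

/-- The weight `u ^ m * exp (-u² / 4)` is dominated by a Gaussian centred at its maximum, which is
attained at `r` with `r ^ 2 = 2 * m`. -/
lemma pow_mul_exp_neg_sq_le_gaussian {m : ℕ} {r u : ℝ} (hr : 0 < r) (hrm : r ^ 2 = 2 * m)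
    (hu : 0 ≤ u) :
    u ^ m * exp (-u ^ 2 / 4) ≤ r ^ m * exp (-(m : ℝ) / 2) * exp (-(1 / 4) * (u - r) ^ 2) := by
  have hle : u / r ≤ exp (u / r - 1) := by linarith [add_one_le_exp (u / r - 1)]
  have hpow : u ^ m ≤ r ^ m * exp (m * (u / r - 1)) := by
    calc u ^ m = r ^ m * (u / r) ^ m := by rw [← mul_pow, mul_div_cancel₀ _ hr.ne']
      _ ≤ r ^ m * exp (u / r - 1) ^ m := by gcongr
      _ = r ^ m * exp (m * (u / r - 1)) := by rw [← exp_nat_mul]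
  calc u ^ m * exp (-u ^ 2 / 4)
      ≤ r ^ m * exp (m * (u / r - 1)) * exp (-u ^ 2 / 4) := by gcongr
    _ = r ^ m * exp (-(m : ℝ) / 2) * exp (-(1 / 4) * (u - r) ^ 2) := by
      rw [mul_assoc, mul_assoc, ← exp_add, ← exp_add]
      have hm : (m : ℝ) = r ^ 2 / 2 := by linarith
      rw [hm]
      congr 2
      field_simp
      ring

lemma integrable_gaussian_sub {b : ℝ} (hb : 0 < b) (r : ℝ) :
    Integrable fun u : ℝ ↦ exp (-b * (u - r) ^ 2) :=
  (integrable_exp_neg_mul_sq hb).comp_sub_right r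

lemma integral_Ioi_gaussian_sub_lt {b : ℝ} (hb : 0 < b) (r a : ℝ) :
    ∫ u in Set.Ioi a, exp (-b * (u - r) ^ 2) < √(π / b) := by
  have hint := integrable_gaussian_sub hb r
  have htot : ∫ u : ℝ, exp (-b * (u - r) ^ 2) = √(π / b) := by
    rw [integral_sub_right_eq_self (fun u : ℝ ↦ exp (-b * u ^ 2)) r, integral_gaussian]
  have hsplit := intervalIntegral.integral_Iic_add_Ioi (b := a) hint.integrableOn hint.integrableOn
  have hpos : 0 < ∫ u in Set.Iic a, exp (-b * (u - r) ^ 2) := by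
    have : NeZero (volume.restrict (Set.Iic a)) := ⟨by simp⟩
    exact integral_exp_pos hint.integrableOn
  linarith

/-- **Proposition 2.2 (the half-line is shorter than the cylinder).**
For every integer `n ≥ 2`, `L_{n,P} = ∫₀^∞ u^(n-1) exp(-u²/4) du` is less than
`L_{n,C} = 2√π (2(n-1))^((n-1)/2) exp(-(n-1)/2)`. -/
theorem halfline_shorter_than_cylinder (n : ℕ) (hn : 2 ≤ n) :
    (∫ u in Set.Ioi (0 : ℝ), u ^ (n - 1) * Real.exp (-u ^ 2 / 4))
      < 2 * Real.sqrt π * (2 * ((n : ℝ) - 1)) ^ (((n : ℝ) - 1) / 2) *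
        Real.exp (-((n : ℝ) - 1) / 2) := by
  obtain ⟨m, rfl⟩ : ∃ m, n = m + 1 := ⟨n - 1, by omega⟩
  have hm : (0 : ℝ) < m := by exact_mod_cast (by omega : 0 < m)
  simp only [Nat.add_sub_cancel, Nat.cast_add, Nat.cast_one, add_sub_cancel_right]
  set r : ℝ := √(2 * m) with hr_def
  have hr : 0 < r := by positivity
  have hrm : r ^ 2 = 2 * m := sq_sqrt (by positivity)
  have hrpow : (2 * (m : ℝ)) ^ ((m : ℝ) / 2) = r ^ m := by
    rw [hr_def, sqrt_eq_rpow, ← rpow_mul_natCast (by positivity)]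
    congr 1
    ring
  have hsqrt : √(π / (1 / 4)) = 2 * √π := by
    rw [show π / (1 / 4) = 2 ^ 2 * π by ring, sqrt_mul (by positivity), sqrt_sq (by positivity)]
  calc ∫ u in Set.Ioi (0 : ℝ), u ^ m * exp (-u ^ 2 / 4)
      ≤ ∫ u in Set.Ioi (0 : ℝ),
          r ^ m * exp (-(m : ℝ) / 2) * exp (-(1 / 4) * (u - r) ^ 2) := by
        refine integral_mono_of_nonneg ?_
          ((integrable_gaussian_sub (by norm_num) r).integrableOn.const_mul _) ?_
        · filter_upwards [ae_restrict_mem measurableSet_Ioi] with u hu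
          have : 0 < u := hu
          simp only [Pi.zero_apply]
          positivity
        · filter_upwards [ae_restrict_mem measurableSet_Ioi] with u hu
          exact pow_mul_exp_neg_sq_le_gaussian hr hrm (le_of_lt hu)
    _ = r ^ m * exp (-(m : ℝ) / 2) *
          ∫ u in Set.Ioi (0 : ℝ), exp (-(1 / 4) * (u - r) ^ 2) := integral_const_mul _ _
    _ < r ^ m * exp (-(m : ℝ) / 2) * (2 * √π) := by
        rw [← hsqrt]
        exact mul_lt_mul_of_pos_left (integral_Ioi_gaussian_sub_lt (by norm_num) r 0)
          (by positivity)
    _ = 2 * √π * (2 * (m : ℝ)) ^ ((m : ℝ) / 2) * exp (-(m : ℝ) / 2) := by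
        rw [hrpow]
        ring
end

section
/- Let n ≥ 2 be an integer and let c₀ > 0 be the unique positive real with e^{−c₀²/4} = 2∫₀^{c₀} e^{−x²/4} dx. Then for every a, b ∈ (0, ∞), 2(a^{n−1} e^{−a²/4} + b^{n−1} e^{−b²/4}) ∫₀^{c₀} e^{−x²/4} dx + 2 e^{−c₀²/4} ∫_a^b r^{n−1} e^{−r²/4} dr < 2 ∫₀^∞ s^{n−1} e^{−s²/4} ds. -/
open Real MeasureTheory

/-- The weight `r ^ m * exp (-r² / 4)`. -/
noncomputable def gaussPow (m : ℕ) (r : ℝ) : ℝ := r ^ m * Real.exp (-r ^ 2 / 4)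

lemma gaussPow_nonneg (m : ℕ) {r : ℝ} (hr : 0 ≤ r) : 0 ≤ gaussPow m r :=
  mul_nonneg (pow_nonneg hr m) (Real.exp_pos _).le

lemma integrable_gaussPow (m : ℕ) : Integrable (gaussPow m) := by
  have h := integrable_rpow_mul_exp_neg_mul_sq (b := 1 / 4) (by norm_num) (s := (m : ℝ))
    (by have := m.cast_nonneg (α := ℝ); linarith)
  refine h.congr (Filter.Eventually.of_forall fun x => ?_)
  simp only [gaussPow, Real.rpow_natCast]
  congr 2
  ring

lemma hasDerivAt_exp_neg_sq_div (r : ℝ) :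
    HasDerivAt (fun r : ℝ => Real.exp (-r ^ 2 / 4)) (Real.exp (-r ^ 2 / 4) * (-r / 2)) r := by
  have h := ((hasDerivAt_pow 2 r).neg.div_const 4).exp
  refine h.congr_deriv ?_
  change Real.exp (-r ^ 2 / 4) * _ = _
  push_cast
  ring

lemma hasDerivAt_gaussPow_zero (r : ℝ) :
    HasDerivAt (gaussPow 0) (-(1 / 2) * gaussPow 1 r) r := by
  have h := hasDerivAt_exp_neg_sq_div r
  have e : gaussPow 0 = fun r : ℝ => Real.exp (-r ^ 2 / 4) := by
    ext r; simp [gaussPow]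
  rw [e]
  convert h using 1
  simp only [gaussPow]
  ring

lemma hasDerivAt_gaussPow_succ (m : ℕ) (r : ℝ) :
    HasDerivAt (gaussPow (m + 1))
      (((m : ℝ) + 1) * gaussPow m r - 1 / 2 * gaussPow (m + 2) r) r := by
  have h := (hasDerivAt_pow (m + 1) r).mul (hasDerivAt_exp_neg_sq_div r)
  refine h.congr_deriv ?_
  simp only [gaussPow]
  push_cast
  ring

lemma tendsto_gaussPow (m : ℕ) : Filter.Tendsto (gaussPow m) Filter.atTop (nhds 0) := by
  refine squeeze_zero' (g := fun r => r ^ m * Real.exp (-r)) ?_ ?_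
    (Real.tendsto_pow_mul_exp_neg_atTop_nhds_zero m)
  · filter_upwards [Filter.eventually_ge_atTop 0] with r hr using gaussPow_nonneg m hr
  · filter_upwards [Filter.eventually_ge_atTop 4] with r hr
    refine mul_le_mul_of_nonneg_left (Real.exp_le_exp.2 ?_) (by positivity)
    nlinarith

/-- The tail integral of the weight. -/
noncomputable def gaussTail (m : ℕ) (b : ℝ) : ℝ := ∫ r in Set.Ioi b, gaussPow m r

lemma gaussTail_nonneg (m : ℕ) {b : ℝ} (hb : 0 ≤ b) : 0 ≤ gaussTail m b :=
  setIntegral_nonneg measurableSet_Ioi fun _ hr => gaussPow_nonneg m (hb.trans (le_of_lt hr))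

lemma gaussTail_sub (m : ℕ) (a b : ℝ) :
    ∫ r in a..b, gaussPow m r = gaussTail m a - gaussTail m b :=
  (intervalIntegral.integral_Ioi_sub_Ioi' (integrable_gaussPow m).integrableOn
    (integrable_gaussPow m).integrableOn).symm

lemma gaussTail_anti (m : ℕ) {a b : ℝ} (ha : 0 ≤ a) (hab : a ≤ b) :
    gaussTail m b ≤ gaussTail m a := by
  rw [← sub_nonneg, ← gaussTail_sub]
  exact intervalIntegral.integral_nonneg hab fun r hr => gaussPow_nonneg m (ha.trans hr.1)

lemma gaussTail_one (b : ℝ) : gaussTail 1 b = 2 * gaussPow 0 b := by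
  have h := integral_Ioi_of_hasDerivAt_of_tendsto' (a := b)
    (fun x _ => hasDerivAt_gaussPow_zero x)
    ((integrable_gaussPow 1).const_mul _).integrableOn (tendsto_gaussPow 0)
  rw [integral_const_mul] at h
  simp only [gaussTail]
  linarith

lemma gaussTail_add_two (m : ℕ) (b : ℝ) :
    gaussTail (m + 2) b = 2 * gaussPow (m + 1) b + 2 * ((m : ℝ) + 1) * gaussTail m b := by
  have i1 := (integrable_gaussPow m).const_mul ((m : ℝ) + 1)
  have i2 := (integrable_gaussPow (m + 2)).const_mul (1 / 2)
  have h := integral_Ioi_of_hasDerivAt_of_tendsto' (a := b)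
    (fun x _ => hasDerivAt_gaussPow_succ m x) (i1.sub i2).integrableOn (tendsto_gaussPow (m + 1))
  rw [integral_sub i1.integrableOn i2.integrableOn, integral_const_mul, integral_const_mul] at h
  simp only [gaussTail]
  linarith

lemma gaussPow_succ_at_zero (m : ℕ) : gaussPow (m + 1) 0 = 0 := by simp [gaussPow]

lemma gaussTail_add_two_zero (m : ℕ) :
    gaussTail (m + 2) 0 = 2 * ((m : ℝ) + 1) * gaussTail m 0 := by
  rw [gaussTail_add_two, gaussPow_succ_at_zero]; ring

lemma gaussTail_one_zero : gaussTail 1 0 = 2 := by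
  rw [gaussTail_one]; simp [gaussPow]

lemma gaussTail_zero_zero : gaussTail 0 0 = √π := by
  have h := integral_gaussian_Ioi (1 / 4)
  have e : gaussPow 0 = fun x : ℝ => Real.exp (-(1 / 4) * x ^ 2) := by
    ext x; simp only [gaussPow]; rw [pow_zero, one_mul]; congr 1; ring
  rw [gaussTail, e, h, show π / (1 / 4) = 2 ^ 2 * π by ring, Real.sqrt_mul (by norm_num),
    Real.sqrt_sq (by norm_num)]
  ring

lemma gaussTail_zero_zero_ge : 1.7 ≤ gaussTail 0 0 := by
  rw [gaussTail_zero_zero]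
  exact Real.le_sqrt_of_sq_le (by nlinarith [Real.pi_gt_three])

lemma gaussTail_zero_pos (m : ℕ) : 0 < gaussTail m 0 := by
  induction m using Nat.twoStepInduction with
  | zero => linarith [gaussTail_zero_zero_ge]
  | one => rw [gaussTail_one_zero]; norm_num
  | more m h _ => rw [gaussTail_add_two_zero]; positivity

lemma gaussPow_succ_le (m : ℕ) {a : ℝ} (ha : 0 ≤ a) :
    gaussPow (m + 1) a ≤ ((m : ℝ) + 1) * (gaussTail m 0 - gaussTail m a) := by
  have h1 := gaussTail_add_two m a
  have h2 := gaussTail_add_two_zero m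
  have h3 := gaussTail_anti (m + 2) le_rfl ha
  linarith

lemma two_gaussPow_le (m : ℕ) {b : ℝ} (hb : 0 ≤ b) :
    2 * gaussPow m b ≤ gaussTail (m + 1) b := by
  cases m with
  | zero => exact (gaussTail_one b).ge
  | succ m =>
    rw [gaussTail_add_two]
    have := gaussTail_nonneg m hb
    have : 0 ≤ 2 * ((m : ℝ) + 1) * gaussTail m b := by positivity
    linarith

lemma mul_exp_neg_le {p t K : ℝ} (h : p ≤ K * Real.exp t) : p * Real.exp (-t) ≤ K := by
  rw [Real.exp_neg, ← div_eq_mul_inv, div_le_iff₀ (Real.exp_pos t)]; exact h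

/-- Bound for the left end from a polynomial inequality. -/
lemma left_le (m : ℕ) {a K : ℝ} (ha : 0 ≤ a) (hK : 0 ≤ K)
    (h : a ^ m * (1 - 2 * a / (m + 1)) ≤ K * (1 + a ^ 2 / 4)) :
    gaussPow m a - 2 * (gaussTail m 0 - gaussTail m a) ≤ K := by
  have h1 := gaussPow_succ_le m ha
  have hm : (0 : ℝ) < m + 1 := by positivity
  rw [mul_comm, ← div_le_iff₀ hm] at h1
  have h2 : a ^ m * (1 - 2 * a / (m + 1)) * Real.exp (-(a ^ 2 / 4)) ≤ K :=
    mul_exp_neg_le (h.trans (mul_le_mul_of_nonneg_left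
      (by linarith [Real.add_one_le_exp (a ^ 2 / 4)]) hK))
  have h3 : gaussPow m a - 2 * (gaussPow (m + 1) a / (m + 1))
      = a ^ m * (1 - 2 * a / (m + 1)) * Real.exp (-(a ^ 2 / 4)) := by
    simp only [gaussPow, neg_div]; field_simp; ring
  linarith

lemma exp_four_mul_le {y : ℝ} (hy : 0 ≤ y) :
    54 * (1 + y + y ^ 2 / 2 + y ^ 3 / 6) ≤ Real.exp (4 + y) := by
  have h1 : (54 : ℝ) ≤ Real.exp 4 := by
    have h := Real.exp_one_gt_d9
    have : Real.exp 4 = Real.exp 1 ^ 4 := by rw [← Real.exp_nat_mul]; norm_num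
    rw [this]
    calc (54 : ℝ) ≤ 2.718 ^ 4 := by norm_num
      _ ≤ _ := by gcongr; linarith
  have h2 : 1 + y + y ^ 2 / 2 + y ^ 3 / 6 ≤ Real.exp y := by
    have := Real.sum_le_exp_of_nonneg hy 4
    simp [Finset.sum_range_succ, Nat.factorial] at this
    linarith
  rw [Real.exp_add]
  exact mul_le_mul h1 h2 (by positivity) (by positivity)

/-- Bound for the right end from a polynomial inequality. -/
lemma right_le (m : ℕ) {b K : ℝ} (hb : 0 ≤ b) (hK : 0 ≤ K)
    (h : ∀ y, 0 ≤ y → y = b ^ 2 / 4 - 4 → 4 ≤ b →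
      b ^ m * (b - 4) ≤ K * (54 * (1 + y + y ^ 2 / 2 + y ^ 3 / 6))) :
    gaussPow (m + 1) b - 2 * gaussTail (m + 1) b ≤ K := by
  have h1 := two_gaussPow_le m hb
  have h3 : gaussPow (m + 1) b - 4 * gaussPow m b
      = b ^ m * (b - 4) * Real.exp (-(b ^ 2 / 4)) := by
    simp only [gaussPow, neg_div]; ring
  have h2 : b ^ m * (b - 4) * Real.exp (-(b ^ 2 / 4)) ≤ K := by
    rcases le_total b 4 with h4 | h4
    · refine le_trans ?_ hK
      exact mul_nonpos_of_nonpos_of_nonneg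
        (mul_nonpos_of_nonneg_of_nonpos (by positivity) (by linarith)) (Real.exp_pos _).le
    · have hy : 0 ≤ b ^ 2 / 4 - 4 := by nlinarith
      refine mul_exp_neg_le ((h _ hy rfl h4).trans (mul_le_mul_of_nonneg_left ?_ hK))
      have := exp_four_mul_le hy
      rwa [show 4 + (b ^ 2 / 4 - 4) = b ^ 2 / 4 by ring] at this
  linarith

lemma left_one_le (a : ℝ) :
    gaussPow 1 a - 2 * (gaussTail 1 0 - gaussTail 1 a) ≤ 0.2325 := by
  rw [gaussTail_one_zero, gaussTail_one]
  have h : (a + 4) * Real.exp (-(a ^ 2 / 4)) ≤ 4.2325 := by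
    refine mul_exp_neg_le ?_
    have := Real.quadratic_le_exp_of_nonneg (x := a ^ 2 / 4) (by positivity)
    nlinarith [sq_nonneg (a ^ 2 - 0.2), sq_nonneg (a - 0.45)]
  simp only [gaussPow, neg_div]
  linarith

lemma right_one_le (b : ℝ) : gaussPow 1 b - 2 * gaussTail 1 b ≤ 0.0034 := by
  rw [gaussTail_one]
  have h : (b - 4) * Real.exp (-(b ^ 2 / 4)) ≤ 0.0034 := by
    refine mul_exp_neg_le ?_
    have h5 : (148 : ℝ) ≤ Real.exp 5 := by
      have h := Real.exp_one_gt_d9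
      have : Real.exp 5 = Real.exp 1 ^ 5 := by rw [← Real.exp_nat_mul]; norm_num
      rw [this]
      calc (148 : ℝ) ≤ 2.718 ^ 5 := by norm_num
        _ ≤ _ := by gcongr; linarith
    have h1 : b ^ 2 / 4 - 4 ≤ Real.exp (b ^ 2 / 4 - 5) := by
      linarith [Real.add_one_le_exp (b ^ 2 / 4 - 5)]
    have h2 : Real.exp (b ^ 2 / 4) = Real.exp 5 * Real.exp (b ^ 2 / 4 - 5) := by
      rw [← Real.exp_add]; congr 1; ring
    have h3 : 148 * Real.exp (b ^ 2 / 4 - 5) ≤ Real.exp (b ^ 2 / 4) := by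
      rw [h2]; gcongr
    rcases le_total b 4 with h4 | h4
    · linarith [Real.exp_pos (b ^ 2 / 4)]
    · nlinarith
  simp only [gaussPow, neg_div]
  linarith

/-- The quartic comparison weight. -/
noncomputable def quarticWeight (k : ℕ) (r : ℝ) : ℝ :=
  27 / 2048 * (r ^ k * ((k : ℝ) + 4 - r ^ 2 / 2) ^ 4 * Real.exp (-r ^ 2 / 4))

lemma quarticWeight_nonneg (k : ℕ) {r : ℝ} (hr : 0 ≤ r) : 0 ≤ quarticWeight k r := by
  have : 0 ≤ ((k : ℝ) + 4 - r ^ 2 / 2) ^ 4 := by positivity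
  unfold quarticWeight
  positivity

lemma quartic_bound (r y : ℝ) : r ^ 3 * y - 2 * r ^ 4 ≤ 27 / 2048 * y ^ 4 := by
  have h : 0 ≤ (y - 8 / 3 * r) ^ 2 * ((y + 8 / 3 * r) ^ 2 + 128 / 9 * r ^ 2) := by positivity
  nlinarith

lemma deriv_gaussPow_le (k : ℕ) {r : ℝ} (hr : 0 ≤ r) :
    ((k : ℝ) + 4) * gaussPow (k + 3) r - 1 / 2 * gaussPow (k + 5) r - 2 * gaussPow (k + 4) r
      ≤ quarticWeight k r := by
  have h := mul_le_mul_of_nonneg_left (quartic_bound r ((k : ℝ) + 4 - r ^ 2 / 2))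
    (gaussPow_nonneg k hr)
  simp only [gaussPow, quarticWeight] at h ⊢
  ring_nf at h ⊢
  linarith

lemma neg_deriv_gaussPow_le (k : ℕ) {r : ℝ} (hr : 0 ≤ r) :
    -(((k : ℝ) + 4) * gaussPow (k + 3) r - 1 / 2 * gaussPow (k + 5) r) - 2 * gaussPow (k + 4) r
      ≤ quarticWeight k r := by
  have h := mul_le_mul_of_nonneg_left (quartic_bound r (-((k : ℝ) + 4 - r ^ 2 / 2)))
    (gaussPow_nonneg k hr)
  simp only [gaussPow, quarticWeight] at h ⊢
  ring_nf at h ⊢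
  linarith

lemma quarticWeight_eq (k : ℕ) : quarticWeight k = fun r =>
    27 / 2048 * ((k : ℝ) + 4) ^ 4 * gaussPow k r
    + -(27 / 1024) * ((k : ℝ) + 4) ^ 3 * gaussPow (k + 2) r
    + 81 / 4096 * ((k : ℝ) + 4) ^ 2 * gaussPow (k + 4) r
    + -(27 / 4096) * ((k : ℝ) + 4) * gaussPow (k + 6) r
    + 27 / 32768 * gaussPow (k + 8) r := by
  ext r
  simp only [quarticWeight, gaussPow]
  ring

lemma integrable_quarticWeight (k : ℕ) : Integrable (quarticWeight k) := by
  rw [quarticWeight_eq]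
  exact (((((integrable_gaussPow _).const_mul _).add ((integrable_gaussPow _).const_mul _)).add
    ((integrable_gaussPow _).const_mul _)).add ((integrable_gaussPow _).const_mul _)).add
    ((integrable_gaussPow _).const_mul _)

lemma integral_quarticWeight (k : ℕ) : ∫ r in Set.Ioi 0, quarticWeight k r =
    27 / 2048 * ((k : ℝ) + 4) ^ 4 * gaussTail k 0
    + -(27 / 1024) * ((k : ℝ) + 4) ^ 3 * gaussTail (k + 2) 0
    + 81 / 4096 * ((k : ℝ) + 4) ^ 2 * gaussTail (k + 4) 0
    + -(27 / 4096) * ((k : ℝ) + 4) * gaussTail (k + 6) 0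
    + 27 / 32768 * gaussTail (k + 8) 0 := by
  have i (j : ℕ) (c : ℝ) : IntegrableOn (fun r => c * gaussPow j r) (Set.Ioi 0) :=
    ((integrable_gaussPow j).const_mul c).integrableOn
  rw [quarticWeight_eq, integral_add _ (i _ _), integral_add _ (i _ _), integral_add _ (i _ _),
    integral_add (i _ _) (i _ _)]
  · simp only [integral_const_mul, gaussTail]
  · exact (i _ _).add (i _ _)
  · exact ((i _ _).add (i _ _)).add (i _ _)
  · exact (((i _ _).add (i _ _)).add (i _ _)).add (i _ _)

lemma integral_quarticWeight_le (k : ℕ) (hk : 1 ≤ k) :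
    ∫ r in Set.Ioi 0, quarticWeight k r ≤ 0.1186 * gaussTail (k + 4) 0 := by
  have hk' : (1 : ℝ) ≤ k := by exact_mod_cast hk
  have h2 := gaussTail_add_two_zero k
  have h4 := gaussTail_add_two_zero (k + 2)
  have h6 := gaussTail_add_two_zero (k + 4)
  have h8 := gaussTail_add_two_zero (k + 6)
  push_cast at h4 h6 h8
  rw [integral_quarticWeight, h8, h6, h4, h2, ← sub_nonneg]
  have hT := gaussTail_zero_pos k
  obtain ⟨x, hx⟩ : ∃ x : ℝ, x = k - 1 := ⟨_, rfl⟩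
  have hx0 : 0 ≤ x := by linarith
  have e : (k : ℝ) = x + 1 := by linarith
  rw [e]
  refine le_of_le_of_eq (mul_nonneg hT.le (?_ : (0 : ℝ) ≤
    (0.4744 - 81 / 2048) * (x + 2) * (x + 4) - 243 / 2048 * (x + 5) ^ 2)) ?_
  · nlinarith
  · ring

lemma ends_le_quartic (k : ℕ) (hk : 1 ≤ k) {a b : ℝ} (ha : 0 ≤ a) (hab : a ≤ b) :
    gaussPow (k + 4) a - 2 * (gaussTail (k + 4) 0 - gaussTail (k + 4) a)
      + (gaussPow (k + 4) b - 2 * gaussTail (k + 4) b) ≤ 0.1186 * gaussTail (k + 4) 0 := by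
  have i (j : ℕ) (c : ℝ) (s : Set ℝ) : IntegrableOn (fun r => c * gaussPow j r) s :=
    ((integrable_gaussPow j).const_mul c).integrableOn
  have iQ (s : Set ℝ) : IntegrableOn (quarticWeight k) s := (integrable_quarticWeight k).integrableOn
  have hb0 : 0 ≤ b := ha.trans hab
  have recb := gaussTail_add_two (k + 3) b
  have reca := gaussTail_add_two (k + 3) a
  have rec0 := gaussTail_add_two_zero (k + 3)
  push_cast at recb reca rec0
  have hR : gaussPow (k + 4) b - 2 * gaussTail (k + 4) b ≤ ∫ r in Set.Ioi b, quarticWeight k r := by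
    have h := setIntegral_mono_on
      (((i (k + 3) ((k : ℝ) + 4) (Set.Ioi b)).sub (i (k + 5) (1 / 2) _)).neg.sub
        (i (k + 4) 2 _)) (iQ _) measurableSet_Ioi
      (fun r hr => neg_deriv_gaussPow_le k (hb0.trans (le_of_lt hr)))
    refine le_of_eq_of_le ?_ h
    simp only [Pi.sub_apply, Pi.neg_apply]
    rw [integral_sub _ (i _ _ _), integral_neg, integral_sub (i _ _ _) (i _ _ _)]
    · simp only [integral_const_mul, gaussTail] at recb ⊢
      linarith
    · exact ((i _ _ _).sub (i _ _ _)).neg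
  have hL : gaussPow (k + 4) a - 2 * (gaussTail (k + 4) 0 - gaussTail (k + 4) a)
      ≤ ∫ r in Set.Ioc 0 a, quarticWeight k r := by
    have h := setIntegral_mono_on
      (((i (k + 3) ((k : ℝ) + 4) (Set.Ioc 0 a)).sub (i (k + 5) (1 / 2) _)).sub
        (i (k + 4) 2 _)) (iQ _) measurableSet_Ioc
      (fun r hr => deriv_gaussPow_le k hr.1.le)
    refine le_of_eq_of_le ?_ h
    simp only [Pi.sub_apply]
    rw [integral_sub _ (i _ _ _), integral_sub (i _ _ _) (i _ _ _)]
    · simp only [← intervalIntegral.integral_of_le ha, intervalIntegral.integral_const_mul,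
        gaussTail_sub]
      linarith
    · exact (i _ _ _).sub (i _ _ _)
  have hsum : (∫ r in Set.Ioc 0 a, quarticWeight k r) + ∫ r in Set.Ioi b, quarticWeight k r
      ≤ ∫ r in Set.Ioi 0, quarticWeight k r := by
    have hd : Disjoint (Set.Ioc 0 a) (Set.Ioi b) := by
      rw [Set.disjoint_left]
      intro r h1 h2
      exact absurd (h1.2.trans hab) (not_le.2 h2)
    rw [← setIntegral_union hd measurableSet_Ioi (iQ _) (iQ _)]
    refine setIntegral_mono_set (iQ _) ?_ (Filter.Eventually.of_forall ?_)
    · exact (ae_restrict_iff' measurableSet_Ioi).2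
        (Filter.Eventually.of_forall fun r hr => quarticWeight_nonneg k (le_of_lt hr))
    · rintro r (hr | hr)
      · exact hr.1
      · exact hb0.trans_lt hr
  linarith [integral_quarticWeight_le k hk]

lemma ends_le (m : ℕ) (hm : 1 ≤ m) {a b : ℝ} (ha : 0 ≤ a) (hab : a ≤ b) :
    gaussPow m a - 2 * (gaussTail m 0 - gaussTail m a)
      + (gaussPow m b - 2 * gaussTail m b) ≤ 0.1186 * gaussTail m 0 := by
  have hb : 0 ≤ b := ha.trans hab
  have h0 := gaussTail_zero_zero_ge
  have h2 := gaussTail_add_two_zero 0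
  have h3 := gaussTail_add_two_zero 1
  have h4 := gaussTail_add_two_zero 2
  rw [gaussTail_one_zero] at h3
  norm_num at h2 h3 h4
  rcases (by omega : m = 1 ∨ m = 2 ∨ m = 3 ∨ m = 4 ∨ 5 ≤ m) with rfl | rfl | rfl | rfl | h5
  · have h1 := right_one_le b
    have h2 := left_one_le a
    rw [gaussTail_one_zero] at *
    linarith
  · have hl := left_le 2 (K := 0.28) ha (by norm_num) (by
      push_cast
      nlinarith [mul_nonneg ha (sq_nonneg (a - 1)), sq_nonneg (a - 1)])
    have hr := right_le 1 (K := 0.04) hb (by norm_num) (by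
      intro y hy hyb h4
      have h1 : b ≤ 4 + y := by nlinarith
      have h2 : b - 4 ≤ y / 2 := by nlinarith
      have h3 : b ^ 1 * (b - 4) ≤ (4 + y) * (y / 2) := by
        rw [pow_one]; exact mul_le_mul h1 h2 (by linarith) (by linarith)
      nlinarith [pow_nonneg hy 2, pow_nonneg hy 3])
    norm_num at hl hr
    linarith
  · have hl := left_le 3 (K := 0.6) ha (by norm_num) (by
      push_cast
      nlinarith [sq_nonneg (a ^ 2 - 1.4 * a), sq_nonneg (a ^ 2 - 2), sq_nonneg (a - 1.4),
        sq_nonneg (a ^ 2 - a / 2 - 1.2)])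
    have hr := right_le 2 (K := 0.15) hb (by norm_num) (by
      intro y hy hyb h4
      have h1 : b ^ 2 ≤ 16 + 4 * y := by nlinarith
      have h2 : b - 4 ≤ y / 2 := by nlinarith
      have h3 : b ^ 2 * (b - 4) ≤ (16 + 4 * y) * (y / 2) :=
        mul_le_mul h1 h2 (by linarith) (by linarith)
      nlinarith [pow_nonneg hy 2, pow_nonneg hy 3])
    norm_num at hl hr
    linarith
  · have hl := left_le 4 (K := 1.7) ha (by norm_num) (by
      push_cast
      nlinarith [mul_nonneg ha (sq_nonneg (a ^ 2 - 1.93 * a)), sq_nonneg (a ^ 2 - 1.93 * a),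
        mul_nonneg ha (sq_nonneg (a - 1.93)), sq_nonneg (a - 1.93),
        mul_nonneg ha (sq_nonneg (a ^ 2 - 1.93 ^ 2)), sq_nonneg (a ^ 2 - 1.93 ^ 2)])
    have hr := right_le 3 (K := 0.6) hb (by norm_num) (by
      intro y hy hyb h4
      have h1 : b ^ 3 ≤ 4 * (4 + y) ^ 2 := by
        have : 4 * (4 + y) ^ 2 = b ^ 4 / 4 := by rw [hyb]; ring
        rw [this]
        nlinarith [pow_nonneg hb 3]
      have h2 : b - 4 ≤ y / 2 := by nlinarith
      have h3 : b ^ 3 * (b - 4) ≤ (4 * (4 + y) ^ 2) * (y / 2) :=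
        mul_le_mul h1 h2 (by linarith) (by positivity)
      nlinarith [pow_nonneg hy 2, pow_nonneg hy 3])
    norm_num at hl hr
    linarith
  · obtain ⟨k, rfl⟩ : ∃ k, m = k + 4 := ⟨m - 4, by omega⟩
    exact ends_le_quartic k (by omega) ha hab

lemma exp_neg_le_quadratic {t : ℝ} (ht : 0 ≤ t) : Real.exp (-t) ≤ 1 - t + t ^ 2 / 2 := by
  have h := Real.quadratic_le_exp_of_nonneg ht
  have h1 := mul_exp_neg_le (p := 1) (K := 1 - t + t ^ 2 / 2) (t := t) (by
    have : 0 ≤ 1 - t + t ^ 2 / 2 := by nlinarith [sq_nonneg (t - 1)]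
    nlinarith [mul_le_mul_of_nonneg_left h this, sq_nonneg (t ^ 2)])
  linarith

lemma integral_exp_lt (c₀ : ℝ) (hc₀ : 0 < c₀)
    (hc₀eq : Real.exp (-c₀ ^ 2 / 4) = 2 * ∫ x in (0:ℝ)..c₀, Real.exp (-x ^ 2 / 4)) :
    (∫ x in (0:ℝ)..c₀, Real.exp (-x ^ 2 / 4)) < 0.472 := by
  rcases le_total c₀ 0.481 with h | h
  · have h1 : (∫ x in (0:ℝ)..c₀, Real.exp (-x ^ 2 / 4))
        ≤ ∫ x in (0:ℝ)..c₀, (1 - 1 / 4 * x ^ 2 + 1 / 32 * x ^ 4) := by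
      refine intervalIntegral.integral_mono_on hc₀.le
        (Continuous.intervalIntegrable (by fun_prop) _ _)
        (Continuous.intervalIntegrable (by fun_prop) _ _) fun x _ => ?_
      have := exp_neg_le_quadratic (t := x ^ 2 / 4) (by positivity)
      rw [neg_div]
      linarith
    have h2 : (∫ x in (0:ℝ)..c₀, (1 - 1 / 4 * x ^ 2 + 1 / 32 * x ^ 4))
        = c₀ - c₀ ^ 3 / 12 + c₀ ^ 5 / 160 := by
      rw [intervalIntegral.integral_add (Continuous.intervalIntegrable (by fun_prop) _ _)
        (Continuous.intervalIntegrable (by fun_prop) _ _), intervalIntegral.integral_sub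
        (Continuous.intervalIntegrable (by fun_prop) _ _)
        (Continuous.intervalIntegrable (by fun_prop) _ _), intervalIntegral.integral_const_mul,
        intervalIntegral.integral_const_mul]
      norm_num
      ring
    have h3 : c₀ ^ 2 ≤ 0.481 ^ 2 := by gcongr
    have h4 : c₀ ^ 5 ≤ 0.481 ^ 2 * c₀ ^ 3 := by
      have := mul_le_mul_of_nonneg_right h3 (pow_nonneg hc₀.le 3)
      linarith [show c₀ ^ 5 = c₀ ^ 2 * c₀ ^ 3 by ring]
    nlinarith [mul_nonneg (sub_nonneg.2 h) (sub_nonneg.2 h), mul_nonneg (sub_nonneg.2 h) hc₀.le,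
      mul_nonneg (sub_nonneg.2 h) (sub_nonneg.2 h3)]
  · have h1 : Real.exp (-c₀ ^ 2 / 4) ≤ Real.exp (-(0.481 ^ 2 / 4)) := by
      refine Real.exp_le_exp.2 ?_
      nlinarith
    have h2 := exp_neg_le_quadratic (t := 0.481 ^ 2 / 4) (by norm_num)
    have h3 : (1 : ℝ) - 0.481 ^ 2 / 4 + (0.481 ^ 2 / 4) ^ 2 / 2 < 0.944 := by norm_num
    linarith

/-- **Proposition 4.2 (perimeter bound for the rectangles).**
With `c₀ > 0` the unique positive real satisfying
`exp(-c₀²/4) = 2 ∫₀^{c₀} exp(-x²/4) dx`, for every `a, b ∈ (0,∞)` the perimeter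
`L_n(a,b,c₀)` of the rectangle `R[a,b,c₀]` is less than twice the length of the
half-line `{x = 0}`. -/
theorem rectangle_perimeter_lt (n : ℕ) (hn : 2 ≤ n) (c₀ : ℝ) (hc₀ : 0 < c₀)
    (hc₀eq : Real.exp (-c₀ ^ 2 / 4) = 2 * ∫ x in (0:ℝ)..c₀, Real.exp (-x ^ 2 / 4)) :
    ∀ a b : ℝ, 0 < a → 0 < b →
      2 * (a ^ (n - 1) * Real.exp (-a ^ 2 / 4) + b ^ (n - 1) * Real.exp (-b ^ 2 / 4)) *
          (∫ x in (0:ℝ)..c₀, Real.exp (-x ^ 2 / 4)) +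
        2 * Real.exp (-c₀ ^ 2 / 4) * (∫ r in a..b, r ^ (n - 1) * Real.exp (-r ^ 2 / 4))
      < 2 * ∫ s in Set.Ioi (0 : ℝ), s ^ (n - 1) * Real.exp (-s ^ 2 / 4) := by
  intro a b ha hb
  obtain ⟨m, rfl⟩ : ∃ m, n = m + 1 := ⟨n - 1, by omega⟩
  have hm : 1 ≤ m := by omega
  simp only [Nat.add_sub_cancel]
  have hJ := integral_exp_lt c₀ hc₀ hc₀eq
  have hJ0 : 0 < ∫ x in (0:ℝ)..c₀, Real.exp (-x ^ 2 / 4) := by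
    linarith [Real.exp_pos (-c₀ ^ 2 / 4)]
  rw [hc₀eq]
  generalize (∫ x in (0:ℝ)..c₀, Real.exp (-x ^ 2 / 4)) = J at hJ hJ0
  change 2 * (gaussPow m a + gaussPow m b) * J + 2 * (2 * J) * (∫ r in a..b, gaussPow m r)
    < 2 * gaussTail m 0
  rw [gaussTail_sub]
  have hT := gaussTail_zero_pos m
  have key : gaussPow m a + gaussPow m b + 2 * (gaussTail m a - gaussTail m b)
      ≤ 2.1186 * gaussTail m 0 := by
    rcases le_total a b with hab | hab
    · linarith [ends_le m hm ha.le hab]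
    · linarith [ends_le m hm hb.le hab, gaussTail_anti m hb.le hab]
  nlinarith [mul_le_mul_of_nonneg_left key hJ0.le, mul_lt_mul_of_pos_right hJ hT]
end

section
/- For every integer n ≥ 7, with ρ = √(2(n+2)), the inequality e^{−2ρ} · ((ρ + 2)/(ρ − 2))^n < 1 holds. Equivalently, Q_n := −h_n'(r_{n+3} + 2)/h_n'(r_{n+3} − 2) < 1 where h_n(s) = s^n e^{−s²/4} and r_{n+3} = √(2(n+2)); this says H_n'(r_{n+3}) > 0 for H_n(s) = h_n(s−2) + h_n(s+2). -/
open Real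

/-- For `y > 1` the logarithm is strictly below the hyperbolic sine of the logarithm. -/
theorem log_lt_half_sub_inv {y : ℝ} (hy : 1 < y) : Real.log y < (y - y⁻¹) / 2 := by
  have h := Real.self_lt_sinh_iff.2 (Real.log_pos hy)
  rwa [Real.sinh_log (by linarith)] at h

/-- **Appendix, key inequality `Q_n < 1`:** for every `n ≥ 7`, with
`ρ = r_{n+3} = √(2(n+2))`, one has `e^{-2ρ} ((ρ+2)/(ρ-2))^n < 1`; equivalently
`H_n'(r_{n+3}) > 0`, where `H_n(s) = h_n(s-2) + h_n(s+2)` and `h_n(s) = s^n e^{-s²/4}`. -/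
theorem Qn_lt_one (n : ℕ) (hn : 7 ≤ n) :
    Real.exp (-2 * Real.sqrt (2 * ((n : ℝ) + 2))) *
        ((Real.sqrt (2 * ((n : ℝ) + 2)) + 2) / (Real.sqrt (2 * ((n : ℝ) + 2)) - 2)) ^ n
      < 1 := by
  have hn' : (7 : ℝ) ≤ n := by exact_mod_cast hn
  set ρ := Real.sqrt (2 * ((n : ℝ) + 2))
  have hsq : ρ ^ 2 = 2 * ((n : ℝ) + 2) := Real.sq_sqrt (by linarith)
  have hρ2 : 2 < ρ := Real.lt_sqrt_of_sq_lt (by linarith)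
  have hsub : 0 < ρ - 2 := by linarith
  have hadd : 0 < ρ + 2 := by linarith
  have hy : 1 < (ρ + 2) / (ρ - 2) := by rw [one_lt_div hsub]; linarith
  have hn_eq : (n : ℝ) = (ρ + 2) * (ρ - 2) / 2 := by linarith
  have hlog : n * Real.log ((ρ + 2) / (ρ - 2)) < 2 * ρ := by
    calc n * Real.log ((ρ + 2) / (ρ - 2))
        < n * (((ρ + 2) / (ρ - 2) - ((ρ + 2) / (ρ - 2))⁻¹) / 2) :=
          mul_lt_mul_of_pos_left (log_lt_half_sub_inv hy) (by linarith)
      _ = 2 * ρ := by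
          rw [hn_eq]
          field_simp
          ring
  rw [← Real.exp_log (pow_pos (one_pos.trans hy) n), Real.log_pow, ← Real.exp_add,
    Real.exp_lt_one_iff]
  linarith
end

section
/- Let n ≥ 2 be an integer, let I ⊆ (0, ∞) be an open interval, and let f : I → ℝ be a twice continuously differentiable function with f > 0 on I satisfying the graphical geodesic equation f''(r)/(1 + f'(r)²) = (r/2 − (n−1)/r) f'(r) − f(r)/2 for all r ∈ I. Then f has no local minimum in I; i.e., there is no ρ ∈ I such that f(r) ≥ f(ρ) for all r in some neighborhood of ρ contained in I. -/
open Real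

/-- At a local minimum, a continuous function has nonnegative second derivative. -/
theorem IsLocalMin.deriv_deriv_nonneg {f : ℝ → ℝ} {a : ℝ} (h : IsLocalMin f a)
    (hc : ContinuousAt f a) : 0 ≤ deriv (deriv f) a := by
  by_contra! hneg
  have hmax : IsLocalMax f a := isLocalMax_of_deriv_deriv_neg hneg h.deriv_eq_zero hc
  have hconst : f =ᶠ[nhds a] fun _ => f a := by
    filter_upwards [h, hmax] with r h₁ h₂ using le_antisymm h₂ h₁
  have hzero : deriv (deriv f) a = 0 := by
    rw [hconst.deriv.deriv_eq]
    simp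
  exact hneg.ne hzero

/-- **Lemma 5.3 (1):** a positive solution of the graphical geodesic equation
`f''/(1+f'²) = (r/2 - (n-1)/r) f' - f/2` on an open interval `I ⊆ (0,∞)` has no
local minimum in `I`. -/
theorem geodesic_no_local_min (n : ℕ) (hn : 2 ≤ n) (I : Set ℝ)
    (hIopen : IsOpen I) (hIconn : I.OrdConnected) (hIsub : I ⊆ Set.Ioi (0 : ℝ))
    (f : ℝ → ℝ) (hf : ContDiffOn ℝ 2 f I) (hfpos : ∀ r ∈ I, 0 < f r)
    (heq : ∀ r ∈ I,
      deriv (deriv f) r / (1 + (deriv f r) ^ 2) =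
        (r / 2 - ((n : ℝ) - 1) / r) * deriv f r - f r / 2) :
    ¬ ∃ ρ ∈ I, ∃ U ∈ nhds ρ, U ⊆ I ∧ ∀ r ∈ U, f ρ ≤ f r := by
  rintro ⟨ρ, hρ, U, hU, -, hmin⟩
  have hloc : IsLocalMin f ρ := Filter.mem_of_superset hU hmin
  have hsecond := hloc.deriv_deriv_nonneg
    (hf.continuousOn.continuousAt (hIopen.mem_nhds hρ))
  have hode := heq ρ hρ
  simp only [hloc.deriv_eq_zero] at hode
  linarith [hfpos ρ hρ]
end

section
/- Let n ≥ 2 be an integer, let I ⊆ (0, ∞) be an open interval, and let f : I → ℝ be a twice continuously differentiable function with f > 0 on I satisfying f''(r)/(1 + f'(r)²) = (r/2 − (n−1)/r) f'(r) − f(r)/2 on I. If ρ₀ ∈ I with ρ₀ < r_n := √(2(n−1)) and f'(ρ₀) ≥ 0, then f''(r) < 0 for every r ∈ I with ρ₀ < r < r_n. -/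
open Real

/-- If `g` is negative at `a` and has negative derivative at each of its zeros in `[a, b]`,
then `g` stays negative on `[a, b]`. -/
theorem neg_of_deriv_neg_at_zeros {g g' : ℝ → ℝ} {a b : ℝ} (hab : a < b)
    (hg : ∀ x ∈ Set.Icc a b, HasDerivAt g (g' x) x) (ha : g a < 0)
    (hzero : ∀ x ∈ Set.Icc a b, g x = 0 → g' x < 0) : g b < 0 := by
  have hle : ∀ x ∈ Set.Icc a b, g x ≤ 0 := fun x hx =>
    image_le_of_deriv_right_lt_deriv_boundary (B := fun _ => 0) (B' := fun _ => 0)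
      (fun x hx => (hg x hx).continuousAt.continuousWithinAt)
      (fun x hx => (hg x (Set.Ico_subset_Icc_self hx)).hasDerivWithinAt) ha.le
      (fun x => hasDerivAt_const x 0)
      (fun x hx h => hzero x (Set.Ico_subset_Icc_self hx) h) hx
  have hb : b ∈ Set.Icc a b := Set.right_mem_Icc.2 hab.le
  refine lt_of_le_of_ne (hle b hb) fun h0 => ?_
  have hd : deriv g b < 0 := (hg b hb).deriv ▸ hzero b hb h0
  have hsign := (eventually_nhdsWithin_sign_eq_of_deriv_neg hd h0).filter_mono
    (nhdsWithin_le_nhds (s := Set.Iio b))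
  obtain ⟨x, hx, hxab⟩ := (hsign.and (Ioo_mem_nhdsLT hab)).exists
  rw [sign_pos (sub_pos.2 hxab.2), sign_eq_one_iff] at hx
  exact (hle x (Set.Ioo_subset_Icc_self hxab)).not_gt hx

/-- **Lemma 5.3 (2):** for a positive solution of the graphical geodesic equation
on an open interval `I ⊆ (0,∞)`, if `f'(ρ₀) ≥ 0` at some `ρ₀ ∈ I` with `ρ₀ < r_n`,
then `f'' < 0` on `(ρ₀, r_n) ∩ I`. -/
theorem geodesic_concave_left (n : ℕ) (hn : 2 ≤ n) (I : Set ℝ)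
    (hIopen : IsOpen I) (hIconn : I.OrdConnected) (hIsub : I ⊆ Set.Ioi (0 : ℝ))
    (f : ℝ → ℝ) (hf : ContDiffOn ℝ 2 f I) (hfpos : ∀ r ∈ I, 0 < f r)
    (heq : ∀ r ∈ I,
      deriv (deriv f) r / (1 + (deriv f r) ^ 2) =
        (r / 2 - ((n : ℝ) - 1) / r) * deriv f r - f r / 2)
    (ρ₀ : ℝ) (hρ₀ : ρ₀ ∈ I) (hρ₀lt : ρ₀ < Real.sqrt (2 * ((n : ℝ) - 1)))
    (hderiv : 0 ≤ deriv f ρ₀) :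
    ∀ r ∈ I, ρ₀ < r → r < Real.sqrt (2 * ((n : ℝ) - 1)) →
      deriv (deriv f) r < 0 := by
  intro r hr hlt hrlt
  have hn1 : (0 : ℝ) < (n : ℝ) - 1 := by
    have : (2 : ℝ) ≤ n := by exact_mod_cast hn
    linarith
  have hsub : ∀ x ∈ Set.Icc ρ₀ r, x ∈ I := fun x hx => hIconn.out hρ₀ hr hx
  have hcoef : ∀ x ∈ Set.Icc ρ₀ r, x / 2 - ((n : ℝ) - 1) / x < 0 := by
    intro x hx
    have hx0 : 0 < x := hIsub (hsub x hx)
    have hsq : x ^ 2 < 2 * ((n : ℝ) - 1) := (Real.lt_sqrt hx0.le).1 (hx.2.trans_lt hrlt)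
    rw [sub_neg, div_lt_div_iff₀ two_pos hx0]
    nlinarith
  have hf' : ∀ x ∈ I, HasDerivAt f (deriv f x) x := fun x hx =>
    ((hf.differentiableOn (by norm_num)).differentiableAt (hIopen.mem_nhds hx)).hasDerivAt
  have hf'' : ∀ x ∈ I, HasDerivAt (deriv f) (deriv (deriv f) x) x := fun x hx =>
    (((hf.deriv_of_isOpen (m := 1) hIopen (by norm_num)).differentiableOn
      (by norm_num)).differentiableAt (hIopen.mem_nhds hx)).hasDerivAt
  have hone : ∀ x, 0 < 1 + deriv f x ^ 2 := fun x => by positivity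
  have key : (r / 2 - ((n : ℝ) - 1) / r) * deriv f r - f r / 2 < 0 := by
    refine neg_of_deriv_neg_at_zeros
      (g := fun x => (x / 2 - ((n : ℝ) - 1) / x) * deriv f x - f x / 2)
      (g' := fun x => (1 / 2 + ((n : ℝ) - 1) / x ^ 2) * deriv f x
        + (x / 2 - ((n : ℝ) - 1) / x) * deriv (deriv f) x - deriv f x / 2) hlt ?_ ?_ ?_
    · intro x hx
      have hx0 : x ≠ 0 := (hIsub (hsub x hx)).ne'
      have hc : HasDerivAt (fun y : ℝ => y / 2 - ((n : ℝ) - 1) / y)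
          (1 / 2 + ((n : ℝ) - 1) / x ^ 2) x := by
        refine (((hasDerivAt_id x).div_const 2).sub
          ((hasDerivAt_const x ((n : ℝ) - 1)).div (hasDerivAt_id x) hx0)).congr_deriv ?_
        simp only [id]
        ring
      exact (hc.mul (hf'' x (hsub x hx))).sub ((hf' x (hsub x hx)).div_const 2)
    · have := mul_nonpos_of_nonpos_of_nonneg (hcoef ρ₀ ⟨le_rfl, hlt.le⟩).le hderiv
      have := hfpos ρ₀ hρ₀
      linarith
    · intro x hx h0
      have hxI := hsub x hx
      have hx0 : 0 < x := hIsub hxI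
      have hsecond : deriv (deriv f) x = 0 :=
        (div_eq_zero_iff.1 ((heq x hxI).trans h0)).resolve_right (hone x).ne'
      have hfirst : deriv f x < 0 :=
        neg_of_mul_pos_right (by linarith [hfpos x hxI]) (hcoef x hx).le
      have := mul_neg_of_pos_of_neg (div_pos hn1 (pow_pos hx0 2)) hfirst
      rw [hsecond]
      linarith
  rw [← heq r hr] at key
  exact (div_neg_iff.1 key).elim (fun h => absurd h.2 (hone r).not_gt) fun h => h.1
end

section
/- Let n ≥ 2 be an integer, let I ⊆ (0, ∞) be an open interval, and let f : I → ℝ be a twice continuously differentiable function with f > 0 on I satisfying f''(r)/(1 + f'(r)²) = (r/2 − (n−1)/r) f'(r) − f(r)/2 on I. If ρ₀ ∈ I with ρ₀ > r_n := √(2(n−1)) and f'(ρ₀) ≤ 0, then f''(r) < 0 for every r ∈ I with r_n < r < ρ₀. -/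
open Real

open Set Filter Topology in
/-- A continuous function on `[a, b]` whose derivative is positive wherever the function is
nonnegative, and which is negative at `b`, is negative at `a`. -/
theorem neg_left_of_deriv_pos_of_nonneg {g g' : ℝ → ℝ} {a b : ℝ} (hab : a ≤ b)
    (hg : ContinuousOn g (Icc a b))
    (hd : ∀ t ∈ Ico a b, 0 ≤ g t → HasDerivAt g (g' t) t ∧ 0 < g' t) (hb : g b < 0) :
    g a < 0 := by
  by_contra! ha
  have hK : IsCompact (Icc a b ∩ g ⁻¹' Ici 0) :=
    isCompact_Icc.of_isClosed_subset (hg.preimage_isClosed_of_isClosed isClosed_Icc isClosed_Ici)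
      inter_subset_left
  obtain ⟨s, ⟨⟨has, hsb⟩, hgs⟩, hmax⟩ := hK.exists_isGreatest ⟨a, ⟨le_rfl, hab⟩, ha⟩
  replace hgs : 0 ≤ g s := hgs
  have hsb' : s < b := lt_of_le_of_ne hsb (by rintro rfl; linarith)
  obtain ⟨hder, hpos⟩ := hd s ⟨has, hsb'⟩ hgs
  have hslope : ∀ᶠ t in 𝓝[>] s, 0 < slope g s t :=
    ((hasDerivAt_iff_tendsto_slope.1 hder).mono_left
      (nhdsWithin_mono s fun _ ht => ne_of_gt ht)).eventually (lt_mem_nhds hpos)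
  obtain ⟨t, hst, htb, hts⟩ := (hslope.and (Ioo_mem_nhdsGT hsb')).exists.imp
    fun t h => (⟨h.1, h.2.2, h.2.1⟩ : 0 < slope g s t ∧ t < b ∧ s < t)
  rw [slope_def_field, div_pos_iff_of_pos_right (sub_pos.2 hts)] at hst
  have : t ≤ s := hmax ⟨⟨has.trans hts.le, htb.le⟩, show 0 ≤ g t by linarith⟩
  linarith

/-- **Lemma 5.3 (3):** for a positive solution of the graphical geodesic equation
on an open interval `I ⊆ (0,∞)`, if `f'(ρ₀) ≤ 0` at some `ρ₀ ∈ I` with `ρ₀ > r_n`,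
then `f'' < 0` on `(r_n, ρ₀) ∩ I`. -/
theorem geodesic_concave_right (n : ℕ) (hn : 2 ≤ n) (I : Set ℝ)
    (hIopen : IsOpen I) (hIconn : I.OrdConnected) (hIsub : I ⊆ Set.Ioi (0 : ℝ))
    (f : ℝ → ℝ) (hf : ContDiffOn ℝ 2 f I) (hfpos : ∀ r ∈ I, 0 < f r)
    (heq : ∀ r ∈ I,
      deriv (deriv f) r / (1 + (deriv f r) ^ 2) =
        (r / 2 - ((n : ℝ) - 1) / r) * deriv f r - f r / 2)
    (ρ₀ : ℝ) (hρ₀ : ρ₀ ∈ I) (hρ₀gt : Real.sqrt (2 * ((n : ℝ) - 1)) < ρ₀)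
    (hderiv : deriv f ρ₀ ≤ 0) :
    ∀ r ∈ I, Real.sqrt (2 * ((n : ℝ) - 1)) < r → r < ρ₀ →
      deriv (deriv f) r < 0 := by
  intro r hr hrn hrρ
  have hn1 : (0 : ℝ) < (n : ℝ) - 1 := by
    have : (2 : ℝ) ≤ n := by exact_mod_cast hn
    linarith
  have hcoef : ∀ t, √(2 * ((n : ℝ) - 1)) < t → 0 < t / 2 - ((n : ℝ) - 1) / t := by
    intro t ht
    have ht0 : 0 < t := (Real.sqrt_nonneg _).trans_lt ht
    have hsq := (Real.sqrt_lt' ht0).1 ht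
    rw [sub_pos, div_lt_div_iff₀ ht0 two_pos]
    linarith
  have hsecond : ∀ t ∈ I, deriv (deriv f) t =
      ((t / 2 - ((n : ℝ) - 1) / t) * deriv f t - f t / 2) * (1 + deriv f t ^ 2) := by
    intro t ht
    rw [← heq t ht, div_mul_cancel₀ _ (by positivity)]
  have hf1 : ∀ t ∈ I, HasDerivAt f (deriv f t) t := fun t ht =>
    ((hf.differentiableOn (by norm_num)).differentiableAt (hIopen.mem_nhds ht)).hasDerivAt
  have hf2 : ∀ t ∈ I, HasDerivAt (deriv f) (deriv (deriv f) t) t := fun t ht =>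
    (((hf.deriv_of_isOpen hIopen (m := 1) (by norm_num)).differentiableOn
      (by norm_num)).differentiableAt (hIopen.mem_nhds ht)).hasDerivAt
  have hg : ∀ t ∈ I,
      HasDerivAt (fun t => (t / 2 - ((n : ℝ) - 1) / t) * deriv f t - f t / 2)
        (((n : ℝ) - 1) / t ^ 2 * deriv f t
          + (t / 2 - ((n : ℝ) - 1) / t) * deriv (deriv f) t) t := by
    intro t ht
    have ht0 : t ≠ 0 := (hIsub ht).ne'
    refine HasDerivAt.congr_deriv (((((hasDerivAt_id t).div_const 2).sub
      ((hasDerivAt_inv ht0).const_mul ((n : ℝ) - 1))).mul (hf2 t ht)).sub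
        ((hf1 t ht).div_const 2)) ?_
    simp only [Pi.sub_apply, id]
    field_simp
    ring
  have hsub : Set.Icc r ρ₀ ⊆ I := hIconn.out hr hρ₀
  rw [hsecond r hr]
  refine mul_neg_of_neg_of_pos ?_ (by positivity)
  refine neg_left_of_deriv_pos_of_nonneg
    (g := fun t => (t / 2 - ((n : ℝ) - 1) / t) * deriv f t - f t / 2) hrρ.le
    (fun t ht => (hg t (hsub ht)).continuousAt.continuousWithinAt)
    (fun t ht hgt => ⟨hg t (hsub (Set.Ico_subset_Icc_self ht)), ?_⟩) ?_
  · have htI := hsub (Set.Ico_subset_Icc_self ht)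
    have ht0 : 0 < t := hIsub htI
    have hc := hcoef t (hrn.trans_le ht.1)
    have hf' : 0 < deriv f t :=
      pos_of_mul_pos_right (by linarith [hfpos t htI]) hc.le
    have hf'' : 0 ≤ deriv (deriv f) t := by
      rw [hsecond t htI]
      exact mul_nonneg hgt (by positivity)
    positivity
  · have := mul_nonpos_of_nonneg_of_nonpos (hcoef ρ₀ hρ₀gt).le hderiv
    linarith [hfpos ρ₀ hρ₀]
end

section
/- Let n ≥ 2 be an integer and let 0 < ξ₁ < ξ₂ < ξ₃. Let f : [ξ₁, ξ₃] → ℝ be continuous, positive, twice differentiable on (ξ₁, ξ₃) with f'' ≤ 0 there, and suppose ∫_{ξ₁}^{ξ₃} f(r)(1 + (n−1)/r²) dr ≤ π. Then f(ξ₂)(ξ₃ − ξ₁)/2 + (n−1) f(ξ₂) (ln(ξ₂/ξ₁) + ξ₁/ξ₂ − 1)/(ξ₂ − ξ₁) + (n−1) f(ξ₂) (ln(ξ₂/ξ₃) + ξ₃/ξ₂ − 1)/(ξ₃ − ξ₂) ≤ π. -/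
open Real MeasureTheory

/-- The Gauss area under the line of slope `k` through `(p, 0)`. -/
theorem integral_line_mul_weight {a b : ℝ} (ha : 0 < a) (hab : a ≤ b) (k p m : ℝ) :
    (∫ r in a..b, k * (r - p) * (1 + m / r ^ 2)) =
      k * ((b - p) ^ 2 / 2 + m * (Real.log b + p / b)) -
        k * ((a - p) ^ 2 / 2 + m * (Real.log a + p / a)) := by
  have hpos : ∀ r ∈ Set.uIcc a b, 0 < r := fun r hr => by
    rw [Set.uIcc_of_le hab] at hr
    exact ha.trans_le hr.1
  refine intervalIntegral.integral_eq_sub_of_hasDerivAt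
    (f := fun r => k * ((r - p) ^ 2 / 2 + m * (Real.log r + p / r))) (fun r hr => ?_) ?_
  · have hr0 : r ≠ 0 := (hpos r hr).ne'
    have hsq := (((hasDerivAt_id' r).sub_const p).pow 2).div_const 2
    have hlog := (Real.hasDerivAt_log hr0).add ((hasDerivAt_inv hr0).const_mul p)
    convert! (hsq.add (hlog.const_mul m)).const_mul k using 1
    field_simp
    ring
  · refine ContinuousOn.intervalIntegrable fun r hr => ContinuousAt.continuousWithinAt ?_
    have hr0 : r ^ 2 ≠ 0 := (pow_pos (hpos r hr) 2).ne'
    fun_prop (disch := assumption)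

/-- If a line through `(p, 0)` lies below the graph of `f`, so does its Gauss area. -/
theorem line_area_le_integral {a b : ℝ} (ha : 0 < a) (hab : a ≤ b) {k p m : ℝ} (hm : 0 ≤ m)
    {f : ℝ → ℝ} (hf : IntervalIntegrable (fun r => f r * (1 + m / r ^ 2)) volume a b)
    (hle : ∀ r ∈ Set.Icc a b, k * (r - p) ≤ f r) :
    k * ((b - p) ^ 2 / 2 + m * (Real.log b + p / b)) -
        k * ((a - p) ^ 2 / 2 + m * (Real.log a + p / a)) ≤
      ∫ r in a..b, f r * (1 + m / r ^ 2) := by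
  rw [← integral_line_mul_weight ha hab]
  refine intervalIntegral.integral_mono_on hab ?_ hf fun r hr => ?_
  · refine ContinuousOn.intervalIntegrable fun r hr => ContinuousAt.continuousWithinAt ?_
    rw [Set.uIcc_of_le hab] at hr
    have hr0 : r ^ 2 ≠ 0 := (pow_pos (ha.trans_le hr.1) 2).ne'
    fun_prop (disch := assumption)
  · exact mul_le_mul_of_nonneg_right (hle r hr) (by positivity)

/-- **Lemma 5.4 (Gauss area of an inscribed triangle):** if `f` is positive and
concave on `[ξ₁, ξ₃]` and the Gauss area under its graph is at most `π`, then
for any `ξ₂ ∈ (ξ₁, ξ₃)` the Gauss area `I + II + III` of the triangle with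
vertices `(ξ₁,0)`, `(ξ₂, f(ξ₂))`, `(ξ₃,0)` is at most `π`. -/
theorem gauss_area_triangle (n : ℕ) (hn : 2 ≤ n) (ξ₁ ξ₂ ξ₃ : ℝ)
    (h1 : 0 < ξ₁) (h12 : ξ₁ < ξ₂) (h23 : ξ₂ < ξ₃)
    (f : ℝ → ℝ) (hfc : ContinuousOn f (Set.Icc ξ₁ ξ₃))
    (hfpos : ∀ r ∈ Set.Icc ξ₁ ξ₃, 0 < f r)
    (hdiff : ∀ r ∈ Set.Ioo ξ₁ ξ₃, DifferentiableAt ℝ f r)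
    (hdiff2 : ∀ r ∈ Set.Ioo ξ₁ ξ₃, DifferentiableAt ℝ (deriv f) r)
    (hconc : ∀ r ∈ Set.Ioo ξ₁ ξ₃, deriv (deriv f) r ≤ 0)
    (harea : (∫ r in ξ₁..ξ₃, f r * (1 + ((n : ℝ) - 1) / r ^ 2)) ≤ π) :
    f ξ₂ * (ξ₃ - ξ₁) / 2 +
        ((n : ℝ) - 1) * f ξ₂ * (Real.log (ξ₂ / ξ₁) + ξ₁ / ξ₂ - 1) / (ξ₂ - ξ₁) +
        ((n : ℝ) - 1) * f ξ₂ * (Real.log (ξ₂ / ξ₃) + ξ₃ / ξ₂ - 1) / (ξ₃ - ξ₂)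
      ≤ π := by
  have h13 : ξ₁ < ξ₃ := h12.trans h23
  have hm : (0 : ℝ) ≤ (n : ℝ) - 1 := by
    have : (2 : ℝ) ≤ n := by exact_mod_cast hn
    linarith
  generalize (n : ℝ) - 1 = m at *
  have h2 : 0 < ξ₂ := h1.trans h12
  have h3 : 0 < ξ₃ := h2.trans h23
  have hcc : ConcaveOn ℝ (Set.Icc ξ₁ ξ₃) f := by
    refine concaveOn_of_deriv2_nonpos (convex_Icc _ _) hfc ?_ ?_ ?_ <;> rw [interior_Icc]
    · exact fun r hr => (hdiff r hr).differentiableWithinAt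
    · exact fun r hr => (hdiff2 r hr).differentiableWithinAt
    · exact hconc
  have hint : ∀ a b, ξ₁ ≤ a → a ≤ b → b ≤ ξ₃ →
      IntervalIntegrable (fun r => f r * (1 + m / r ^ 2)) volume a b := by
    intro a b ha hab hb
    refine ContinuousOn.intervalIntegrable ?_
    rw [Set.uIcc_of_le hab]
    refine (hfc.mono (Set.Icc_subset_Icc ha hb)).mul fun r hr => ContinuousAt.continuousWithinAt ?_
    have hr0 : r ^ 2 ≠ 0 := (pow_pos (h1.trans_le (ha.trans hr.1)) 2).ne'
    fun_prop (disch := assumption)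
  have hm1 : ξ₁ ∈ Set.Icc ξ₁ ξ₃ := ⟨le_rfl, h13.le⟩
  have hm2 : ξ₂ ∈ Set.Icc ξ₁ ξ₃ := ⟨h12.le, h23.le⟩
  have hm3 : ξ₃ ∈ Set.Icc ξ₁ ξ₃ := ⟨h13.le, le_rfl⟩
  have hd1 : 0 < ξ₂ - ξ₁ := sub_pos.2 h12
  have hd2 : 0 < ξ₃ - ξ₂ := sub_pos.2 h23
  have hleft : ∀ r ∈ Set.Icc ξ₁ ξ₂, f ξ₂ / (ξ₂ - ξ₁) * (r - ξ₁) ≤ f r := by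
    intro r hr
    have hs := hcc.2 hm1 hm2
      (div_nonneg (sub_nonneg.2 hr.2) hd1.le) (div_nonneg (sub_nonneg.2 hr.1) hd1.le)
      (show (ξ₂ - r) / (ξ₂ - ξ₁) + (r - ξ₁) / (ξ₂ - ξ₁) = 1 by field_simp; ring)
    have he : (ξ₂ - r) / (ξ₂ - ξ₁) * ξ₁ + (r - ξ₁) / (ξ₂ - ξ₁) * ξ₂ = r := by
      field_simp; ring
    simp only [smul_eq_mul] at hs
    rw [he] at hs
    have := mul_nonneg (div_nonneg (sub_nonneg.2 hr.2) hd1.le) (hfpos _ hm1).le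
    calc _ = (r - ξ₁) / (ξ₂ - ξ₁) * f ξ₂ := by ring
      _ ≤ f r := by linarith
  have hright : ∀ r ∈ Set.Icc ξ₂ ξ₃, -(f ξ₂ / (ξ₃ - ξ₂)) * (r - ξ₃) ≤ f r := by
    intro r hr
    have hs := hcc.2 hm2 hm3
      (div_nonneg (sub_nonneg.2 hr.2) hd2.le) (div_nonneg (sub_nonneg.2 hr.1) hd2.le)
      (show (ξ₃ - r) / (ξ₃ - ξ₂) + (r - ξ₂) / (ξ₃ - ξ₂) = 1 by field_simp; ring)
    have he : (ξ₃ - r) / (ξ₃ - ξ₂) * ξ₂ + (r - ξ₂) / (ξ₃ - ξ₂) * ξ₃ = r := by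
      field_simp; ring
    simp only [smul_eq_mul] at hs
    rw [he] at hs
    have := mul_nonneg (div_nonneg (sub_nonneg.2 hr.1) hd2.le) (hfpos _ hm3).le
    calc _ = (ξ₃ - r) / (ξ₃ - ξ₂) * f ξ₂ := by ring
      _ ≤ f r := by linarith
  have i1 := hint ξ₁ ξ₂ le_rfl h12.le h23.le
  have i2 := hint ξ₂ ξ₃ h12.le h23.le le_rfl
  rw [← intervalIntegral.integral_add_adjacent_intervals i1 i2] at harea
  have b1 := line_area_le_integral h1 h12.le hm i1 hleft
  have b2 := line_area_le_integral h2 h23.le hm i2 hright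
  refine le_trans (le_of_eq ?_) ((add_le_add b1 b2).trans harea)
  rw [Real.log_div h2.ne' h1.ne', Real.log_div h2.ne' h3.ne']
  field_simp
  ring
end

section
/- Let n ≥ 2 be an integer, r_n = √(2(n−1)), and 0 < ε₀ < r_n < R₀. Let f : [ε₀, R₀] → ℝ be twice continuously differentiable, positive on [ε₀, R₀], satisfying f''(r)/(1 + f'(r)²) = (r/2 − (n−1)/r) f'(r) − f(r)/2 on [ε₀, R₀], and suppose ∫_{ε₀}^{R₀} f(r)(1 + (n−1)/r²) dr ≤ π. Then f(r) ≤ max(f(R₀), 2π/(R₀ − r_n)) for every r ∈ [r_n, R₀]. -/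
open Real MeasureTheory

/-- The integral of a concave function over an interval is at least the area of the trapezoid below
its chord. -/
lemma ConcaveOn.trapezoid_le_integral {f : ℝ → ℝ} {p q : ℝ} (hpq : p ≤ q)
    (hf : ConcaveOn ℝ (Set.Icc p q) f) (hfc : ContinuousOn f (Set.Icc p q)) :
    (f p + f q) * (q - p) / 2 ≤ ∫ x in p..q, f x := by
  rcases hpq.eq_or_lt with rfl | hlt
  · simp
  have hqp : 0 < q - p := sub_pos.2 hlt
  have hchord : ∫ x in p..q, (f p + (f q - f p) / (q - p) * (x - p))
      = (f p + f q) * (q - p) / 2 := by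
    have hderiv : ∀ x ∈ Set.uIcc p q,
        HasDerivAt (fun x => f p * x + (f q - f p) / (q - p) * ((x - p) ^ 2 / 2))
          (f p + (f q - f p) / (q - p) * (x - p)) x := by
      intro x _
      have h := ((hasDerivAt_id x).const_mul (f p)).add
        (((((hasDerivAt_id x).sub_const p).pow 2).div_const 2).const_mul
          ((f q - f p) / (q - p)))
      exact h.congr_deriv (by simp)
    rw [intervalIntegral.integral_eq_sub_of_hasDerivAt hderiv
      (Continuous.intervalIntegrable (by fun_prop) _ _)]
    field_simp
    ring
  rw [← hchord]
  refine intervalIntegral.integral_mono_on hpq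
    (Continuous.intervalIntegrable (by fun_prop) _ _) (hfc.intervalIntegrable_of_Icc hpq) ?_
  intro x hx
  have h : (q - x) / (q - p) * f p + (x - p) / (q - p) * f q
      ≤ f ((q - x) / (q - p) * p + (x - p) / (q - p) * q) :=
    hf.2 (Set.left_mem_Icc.2 hpq) (Set.right_mem_Icc.2 hpq)
      (div_nonneg (sub_nonneg.2 hx.2) hqp.le) (div_nonneg (sub_nonneg.2 hx.1) hqp.le)
      (by field_simp; ring)
  have hx' : (q - x) / (q - p) * p + (x - p) / (q - p) * q = x := by
    field_simp; ring
  rw [hx'] at h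
  refine le_trans (le_of_eq ?_) h
  field_simp
  ring

/-- A nonnegative concave function on an interval has integral at least the area of the triangle
over the interval with apex at any point of its graph. -/
lemma ConcaveOn.triangle_le_integral {f : ℝ → ℝ} {p q m : ℝ} (hm : m ∈ Set.Icc p q)
    (hf : ConcaveOn ℝ (Set.Icc p q) f) (hfc : ContinuousOn f (Set.Icc p q))
    (hp : 0 ≤ f p) (hq : 0 ≤ f q) :
    f m * (q - p) / 2 ≤ ∫ x in p..q, f x := by
  have hl : Set.Icc p m ⊆ Set.Icc p q := Set.Icc_subset_Icc_right hm.2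
  have hr : Set.Icc m q ⊆ Set.Icc p q := Set.Icc_subset_Icc_left hm.1
  have h₁ := (hf.subset hl (convex_Icc _ _)).trapezoid_le_integral hm.1 (hfc.mono hl)
  have h₂ := (hf.subset hr (convex_Icc _ _)).trapezoid_le_integral hm.2 (hfc.mono hr)
  rw [← intervalIntegral.integral_add_adjacent_intervals
    ((hfc.mono hl).intervalIntegrable_of_Icc hm.1) ((hfc.mono hr).intervalIntegrable_of_Icc hm.2)]
  nlinarith [mul_nonneg hp (sub_nonneg.2 hm.1), mul_nonneg hq (sub_nonneg.2 hm.2)]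

/-- If a solution `u` of `u'' = (1 + u'²) ((x/2 - k/x) u' - u/2)` with `p² = 2k` has `u' ≤ 0` at
`m` then `u'' < 0` from `m` on. -/
lemma shrinker_bracket_neg_right {u u' u'' : ℝ → ℝ} {k p m R : ℝ}
    (hp : 0 < p) (hpk : p ^ 2 = 2 * k) (hpm : p ≤ m)
    (hu : ∀ x ∈ Set.Ico p R, HasDerivAt u (u' x) x)
    (hu' : ∀ x ∈ Set.Ico p R, HasDerivAt u' (u'' x) x)
    (hpos : ∀ x ∈ Set.Ico p R, 0 < u x)
    (heq : ∀ x ∈ Set.Ico p R, u'' x = (1 + u' x ^ 2) * ((x / 2 - k / x) * u' x - u x / 2))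
    (hm : u' m ≤ 0) :
    ∀ x ∈ Set.Ico m R, (x / 2 - k / x) * u' x - u x / 2 < 0 := by
  have hcoef : ∀ x ∈ Set.Ico p R, 0 ≤ x / 2 - k / x := by
    intro x hx
    have hx0 : 0 < x := hp.trans_le hx.1
    have : x / 2 - k / x = (x ^ 2 - p ^ 2) / (2 * x) := by rw [hpk]; field_simp
    rw [this]
    exact div_nonneg (by nlinarith [hx.1]) (by positivity)
  intro b hb
  by_contra! hcon
  have hsub : Set.Icc m b ⊆ Set.Ico p R := fun x hx => ⟨hpm.trans hx.1, hx.2.trans_lt hb.2⟩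
  have hcont : ContinuousOn (fun x => (x / 2 - k / x) * u' x - u x / 2) (Set.Icc m b) := by
    intro x hx
    have hx0 : x ≠ 0 := (hp.trans_le (hsub hx).1).ne'
    exact ((((continuousAt_id.div_const 2).sub (continuousAt_const.div continuousAt_id hx0)).mul
      (hu' x (hsub hx)).continuousAt).sub
      ((hu x (hsub hx)).continuousAt.div_const 2)).continuousWithinAt
  obtain ⟨s, ⟨hs, hs0⟩, hleast⟩ := (isCompact_Icc.of_isClosed_subset
    (hcont.preimage_isClosed_of_isClosed isClosed_Icc isClosed_Ici)
    Set.inter_subset_left).exists_isLeast ⟨b, Set.right_mem_Icc.2 hb.1, hcon⟩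
  have hsm : Set.Icc m s ⊆ Set.Ico p R := (Set.Icc_subset_Icc_right hs.2).trans hsub
  have hanti : AntitoneOn u' (Set.Icc m s) := by
    refine antitoneOn_of_hasDerivWithinAt_nonpos (f' := u'') (convex_Icc _ _)
      (fun x hx => (hu' x (hsm hx)).continuousAt.continuousWithinAt)
      (fun x hx => (hu' x (hsm (interior_subset hx))).hasDerivWithinAt) ?_
    intro x hx
    rw [interior_Icc] at hx
    rw [heq x (hsm (Set.Ioo_subset_Icc_self hx))]
    refine mul_nonpos_of_nonneg_of_nonpos (by positivity) ?_
    by_contra! hc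
    exact hx.2.not_ge (hleast ⟨⟨hx.1.le, hx.2.le.trans hs.2⟩, hc.le⟩)
  have hs' : u' s ≤ 0 :=
    (hanti (Set.left_mem_Icc.2 hs.1) (Set.right_mem_Icc.2 hs.1) hs.1).trans hm
  have hs0' : 0 ≤ (s / 2 - k / s) * u' s - u s / 2 := hs0
  linarith [mul_nonpos_of_nonneg_of_nonpos (hcoef s (hsub hs)) hs', hpos s (hsub hs)]

/-- If a solution `u` of `u'' = (1 + u'²) ((x/2 - k/x) u' - u/2)` with `p² = 2k` has a critical
point `m`, then `u'' < 0` between `p` and `m`. -/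
lemma shrinker_bracket_neg_left {u u' u'' : ℝ → ℝ} {k p m R : ℝ}
    (hp : 0 < p) (hpk : p ^ 2 = 2 * k) (hmR : m < R)
    (hu : ∀ x ∈ Set.Ico p R, HasDerivAt u (u' x) x)
    (hu' : ∀ x ∈ Set.Ico p R, HasDerivAt u' (u'' x) x)
    (hpos : ∀ x ∈ Set.Ico p R, 0 < u x)
    (heq : ∀ x ∈ Set.Ico p R, u'' x = (1 + u' x ^ 2) * ((x / 2 - k / x) * u' x - u x / 2))
    (hm : u' m = 0) :
    ∀ x ∈ Set.Icc p m, (x / 2 - k / x) * u' x - u x / 2 < 0 := by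
  intro b hb
  by_contra! hcon
  have hk : 0 < k := by nlinarith
  have hsub : Set.Icc b m ⊆ Set.Ico p R := fun x hx => ⟨hb.1.trans hx.1, hx.2.trans_lt hmR⟩
  have hcont : ContinuousOn (fun x => (x / 2 - k / x) * u' x - u x / 2) (Set.Icc b m) := by
    intro x hx
    have hx0 : x ≠ 0 := (hp.trans_le (hsub hx).1).ne'
    exact ((((continuousAt_id.div_const 2).sub (continuousAt_const.div continuousAt_id hx0)).mul
      (hu' x (hsub hx)).continuousAt).sub
      ((hu x (hsub hx)).continuousAt.div_const 2)).continuousWithinAt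
  obtain ⟨s, ⟨hs, hs0⟩, hgreatest⟩ := (isCompact_Icc.of_isClosed_subset
    (hcont.preimage_isClosed_of_isClosed isClosed_Icc isClosed_Ici)
    Set.inter_subset_left).exists_isGreatest ⟨b, Set.left_mem_Icc.2 hb.2, hcon⟩
  have hs0' : 0 ≤ (s / 2 - k / s) * u' s - u s / 2 := hs0
  have hspos : 0 < s := hp.trans_le (hsub hs).1
  have hneg : ∀ x ∈ Set.Ioc s m, (x / 2 - k / x) * u' x - u x / 2 < 0 := by
    intro x hx
    by_contra! hc
    exact hx.1.not_ge (hgreatest ⟨⟨hs.1.trans hx.1.le, hx.2⟩, hc⟩)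
  have hlt : s < m := by
    refine hs.2.lt_of_ne fun h => ?_
    rw [h, hm] at hs0'
    linarith [hpos m (hsub (Set.right_mem_Icc.2 hb.2))]
  have hsm : Set.Icc s m ⊆ Set.Ico p R := (Set.Icc_subset_Icc_left hs.1).trans hsub
  have hanti : StrictAntiOn u' (Set.Icc s m) := by
    refine strictAntiOn_of_hasDerivWithinAt_neg (f' := u'') (convex_Icc _ _)
      (fun x hx => (hu' x (hsm hx)).continuousAt.continuousWithinAt)
      (fun x hx => (hu' x (hsm (interior_subset hx))).hasDerivWithinAt) ?_
    intro x hx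
    rw [interior_Icc] at hx
    rw [heq x (hsm (Set.Ioo_subset_Icc_self hx))]
    exact mul_neg_of_pos_of_neg (by positivity) (hneg x (Set.Ioo_subset_Ioc_self hx))
  have hs' : 0 < u' s := by
    have := hanti (Set.left_mem_Icc.2 hlt.le) (Set.right_mem_Icc.2 hlt.le) hlt
    rwa [hm] at this
  have hcoef : 0 ≤ s / 2 - k / s := by
    have : s / 2 - k / s = (s ^ 2 - p ^ 2) / (2 * s) := by rw [hpk]; field_simp
    rw [this]
    exact div_nonneg (by nlinarith [(hsub hs).1]) (by positivity)
  have hs'' : 0 ≤ u'' s := by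
    rw [heq s (hsub hs)]
    exact mul_nonneg (by positivity) hs0'
  have hderiv : HasDerivAt (fun x => (x / 2 - k / x) * u' x - u x / 2)
      (k / s ^ 2 * u' s + (s / 2 - k / s) * u'' s) s := by
    have h := ((((hasDerivAt_id s).div_const 2).sub
      ((hasDerivAt_const s k).div (hasDerivAt_id s) hspos.ne')).mul (hu' s (hsub hs))).sub
      ((hu s (hsub hs)).div_const 2)
    refine h.congr_deriv ?_
    simp only [id_eq, Pi.sub_apply, Pi.div_apply]
    field_simp
    ring
  have hslope := (hasDerivWithinAt_iff_tendsto_slope' (Set.self_notMem_Ioi)).1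
    (hderiv.hasDerivWithinAt (s := Set.Ioi s))
  have hle : k / s ^ 2 * u' s + (s / 2 - k / s) * u'' s ≤ 0 := by
    refine le_of_tendsto hslope ?_
    filter_upwards [Ioc_mem_nhdsGT hlt] with x hx
    rw [slope_def_field]
    exact div_nonpos_of_nonpos_of_nonneg (by linarith [hneg x hx]) (sub_nonneg.2 hx.1.le)
  have : 0 < k / s ^ 2 * u' s := by positivity
  linarith [mul_nonneg hcoef hs'']

/-- **Lemma 5.6, right side:** a positive graphical geodesic on `[ε₀, R₀]` with
`ε₀ < r_n < R₀` whose graph bounds Gauss area at most `π` satisfies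
`f ≤ max (f(R₀), 2π/(R₀ - r_n))` on `[r_n, R₀]`. -/
theorem geodesic_bounded_right (n : ℕ) (hn : 2 ≤ n) (ε₀ R₀ : ℝ)
    (hε₀ : 0 < ε₀) (hlt : ε₀ < Real.sqrt (2 * ((n : ℝ) - 1)))
    (hgt : Real.sqrt (2 * ((n : ℝ) - 1)) < R₀)
    (f : ℝ → ℝ) (hf : ContDiffOn ℝ 2 f (Set.Icc ε₀ R₀))
    (hfpos : ∀ r ∈ Set.Icc ε₀ R₀, 0 < f r)
    (heq : ∀ r ∈ Set.Icc ε₀ R₀,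
      deriv (deriv f) r / (1 + (deriv f r) ^ 2) =
        (r / 2 - ((n : ℝ) - 1) / r) * deriv f r - f r / 2)
    (harea : (∫ r in ε₀..R₀, f r * (1 + ((n : ℝ) - 1) / r ^ 2)) ≤ π) :
    ∀ r ∈ Set.Icc (Real.sqrt (2 * ((n : ℝ) - 1))) R₀,
      f r ≤ max (f R₀) (2 * π / (R₀ - Real.sqrt (2 * ((n : ℝ) - 1)))) := by
  have hk : 0 < (n : ℝ) - 1 := by
    have : (2 : ℝ) ≤ n := by exact_mod_cast hn
    linarith
  have hpk : Real.sqrt (2 * ((n : ℝ) - 1)) ^ 2 = 2 * ((n : ℝ) - 1) :=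
    Real.sq_sqrt (by positivity)
  set p := Real.sqrt (2 * ((n : ℝ) - 1))
  set k := (n : ℝ) - 1
  have hp : 0 < p := hε₀.trans hlt
  have hεR : ε₀ ≤ R₀ := (hlt.trans hgt).le
  have hsub : Set.Icc p R₀ ⊆ Set.Icc ε₀ R₀ := Set.Icc_subset_Icc_left hlt.le
  have hfc : ContinuousOn f (Set.Icc p R₀) := hf.continuousOn.mono hsub
  have hIco : ∀ x ∈ Set.Ico p R₀, x ∈ Set.Icc ε₀ R₀ := fun x hx => hsub ⟨hx.1, hx.2.le⟩
  have hf2 : ∀ x ∈ Set.Ico p R₀, ContDiffAt ℝ 2 f x := fun x hx =>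
    hf.contDiffAt (Icc_mem_nhds (hlt.trans_le hx.1) hx.2)
  have hu : ∀ x ∈ Set.Ico p R₀, HasDerivAt f (deriv f x) x := fun x hx =>
    ((hf2 x hx).differentiableAt (by norm_num)).hasDerivAt
  have hu' : ∀ x ∈ Set.Ico p R₀, HasDerivAt (deriv f) (deriv (deriv f) x) x := fun x hx =>
    (((hf2 x hx).derivWithin (m := 1) (by norm_num)).differentiableAt one_ne_zero).hasDerivAt
  have hpos : ∀ x ∈ Set.Ico p R₀, 0 < f x := fun x hx => hfpos x (hIco x hx)
  have hode : ∀ x ∈ Set.Ico p R₀, deriv (deriv f) x =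
      (1 + deriv f x ^ 2) * ((x / 2 - k / x) * deriv f x - f x / 2) := by
    intro x hx
    rw [← heq x (hIco x hx)]
    field_simp
  obtain ⟨m, hm, hmax⟩ := isCompact_Icc.exists_isMaxOn (Set.nonempty_Icc.2 hgt.le) hfc
  intro r hr
  refine (hmax hr).trans ?_
  rcases hm.2.eq_or_lt with rfl | hmR
  · exact le_max_left _ _
  refine le_max_of_le_right ?_
  have hmIco : m ∈ Set.Ico p R₀ := ⟨hm.1, hmR⟩
  have hcrit : p < m → deriv f m = 0 := fun h =>
    (hmax.isLocalMax (Icc_mem_nhds h hmR)).deriv_eq_zero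
  have hm' : deriv f m ≤ 0 := by
    refine le_of_tendsto ((hasDerivWithinAt_iff_tendsto_slope' Set.self_notMem_Ioi).1
      ((hu m hmIco).hasDerivWithinAt (s := Set.Ioi m))) ?_
    filter_upwards [Ioc_mem_nhdsGT hmR] with x hx
    rw [slope_def_field]
    exact div_nonpos_of_nonpos_of_nonneg
      (sub_nonpos.2 (hmax ⟨hm.1.trans hx.1.le, hx.2⟩)) (sub_nonneg.2 hx.1.le)
  have hconcave : ConcaveOn ℝ (Set.Icc p R₀) f := by
    have hint : interior (Set.Icc p R₀) ⊆ Set.Ico p R₀ := by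
      rw [interior_Icc]; exact Set.Ioo_subset_Ico_self
    refine concaveOn_of_hasDerivWithinAt2_nonpos (convex_Icc _ _) hfc
      (fun x hx => (hu x (hint hx)).hasDerivWithinAt)
      (fun x hx => (hu' x (hint hx)).hasDerivWithinAt) ?_
    intro x hx
    rw [hode x (hint hx)]
    refine mul_nonpos_of_nonneg_of_nonpos (by positivity) (le_of_lt ?_)
    rcases le_or_gt m x with hmx | hxm
    · exact shrinker_bracket_neg_right hp hpk hm.1 hu hu' hpos hode hm' x ⟨hmx, (hint hx).2⟩
    · exact shrinker_bracket_neg_left hp hpk hmR hu hu' hpos hode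
        (hcrit ((hint hx).1.trans_lt hxm)) x ⟨(hint hx).1, hxm.le⟩
  have htri := hconcave.triangle_le_integral hm hfc
    (hfpos p ⟨hlt.le, hgt.le⟩).le (hfpos R₀ ⟨hεR, le_rfl⟩).le
  have hgc : ContinuousOn (fun x => f x * (1 + k / x ^ 2)) (Set.Icc ε₀ R₀) := by
    refine hf.continuousOn.mul (continuousOn_const.add
      (continuousOn_const.div (continuousOn_id.pow 2) fun x hx => ?_))
    exact pow_ne_zero 2 (hε₀.trans_le hx.1).ne'
  have hmono : ∫ x in p..R₀, f x ≤ ∫ x in p..R₀, f x * (1 + k / x ^ 2) := by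
    refine intervalIntegral.integral_mono_on hgt.le (hfc.intervalIntegrable_of_Icc hgt.le)
      ((hgc.mono hsub).intervalIntegrable_of_Icc hgt.le) fun x hx => ?_
    exact le_mul_of_one_le_right (hfpos x (hsub hx)).le (le_add_of_nonneg_right (by positivity))
  have hmono' : ∫ x in p..R₀, f x * (1 + k / x ^ 2) ≤ ∫ x in ε₀..R₀, f x * (1 + k / x ^ 2) := by
    refine intervalIntegral.integral_mono_interval hlt.le hgt.le le_rfl ?_
      (hgc.intervalIntegrable_of_Icc hεR)
    refine (ae_restrict_iff' measurableSet_Ioc).2 (Filter.Eventually.of_forall fun x hx => ?_)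
    exact mul_nonneg (hfpos x ⟨hx.1.le, hx.2⟩).le (by positivity)
  rw [le_div_iff₀ (sub_pos.2 hgt)]
  linarith
end
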